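/- arXiv:2411.00798 — 2 statements merged into one kernel-verified Lean document; each statement's English description precedes it below -/
import Mathlib

section
/- Suppose {P_n}_{n≥0} is a sequence of monic orthogonal polynomials for the Laguerre-type weight W_L. Then for every n ≥ 0 there exists a constant matrix Λ_n ∈ Mat_N(ℂ) such that P_n·D_L = Λ_n P_n (equality of matrix polynomials). In other words, the monic orthogonal polynomials of W_L are eigenfunctions of the second-order differential operator D_L, so W_L is a solution of the Matrix Bochner Problem. -/
open Polynomial MeasureTheory Matrix

noncomputable section

abbrev Mat (N : ℕ) := Matrix (Fin N) (Fin N) ℂ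

/-- The matrix unit with a `1` in the (1-indexed) entry `(s, t)` and `0` elsewhere. -/
def EU (N : ℕ) (s t : ℕ) : Mat N :=
  Matrix.of fun p q => if (p : ℕ) + 1 = s ∧ (q : ℕ) + 1 = t then 1 else 0

/-- Evaluation of a matrix polynomial at a real point. -/
def mval {N : ℕ} (P : Polynomial (Mat N)) (x : ℝ) : Mat N :=
  Polynomial.eval ((x : ℂ) • (1 : Mat N)) P

/-- The nilpotent matrix `A = Σ a_{2j-1} E_{2j-1,2j} + Σ a_{2j} E_{2j+1,2j}`. -/
def Amat (N : ℕ) (a : ℕ → ℝ) : Mat N :=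
  (∑ j ∈ Finset.Icc 1 (N / 2), (a (2 * j - 1) : ℂ) • EU N (2 * j - 1) (2 * j)) +
  (∑ j ∈ Finset.Icc 1 ((N - 1) / 2), (a (2 * j) : ℂ) • EU N (2 * j + 1) (2 * j))

/-- `K = Σ_{j=1}^{⌊N/2⌋} E_{2j,2j}`. -/
def Kmat (N : ℕ) : Mat N := ∑ j ∈ Finset.Icc 1 (N / 2), EU N (2 * j) (2 * j)

/-- `T(x) = I + x A`. -/
def Tmat (N : ℕ) (a : ℕ → ℝ) (x : ℝ) : Mat N := 1 + (x : ℂ) • Amat N a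

/-- The diagonal Laguerre weight `diag(e^{-x}x^{α₁}, …, e^{-x}x^{α_N})` (1-indexed `α`). -/
def laguerreDiag (N : ℕ) (α : ℕ → ℝ) (x : ℝ) : Mat N :=
  Matrix.diagonal fun i => ((Real.exp (-x) * x ^ α ((i : ℕ) + 1) : ℝ) : ℂ)

/-- The Laguerre-type weight `W_L(x) = T(x) · diag(…) · T(x)^*`. -/
def WL (N : ℕ) (a α : ℕ → ℝ) (x : ℝ) : Mat N :=
  Tmat N a x * laguerreDiag N α x * (Tmat N a x)ᴴ

/-- `B = diag(α₁+1, …, α_N+1)`. -/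
def BL (N : ℕ) (α : ℕ → ℝ) : Mat N :=
  Matrix.diagonal fun i => ((α ((i : ℕ) + 1) + 1 : ℝ) : ℂ)

/-- The right action of the differential operator `D_L`:
`P·D_L = xP'' + P'·(B − xI + 2xA + x(AB − BA)) + P·(AB + K)`. -/
def DL {N : ℕ} (a α : ℕ → ℝ) (P : Polynomial (Mat N)) : Polynomial (Mat N) :=
  Polynomial.X * derivative (derivative P)
    + derivative P * (Polynomial.C (BL N α)
        + Polynomial.X *
            Polynomial.C (2 • Amat N a + Amat N a * BL N α - BL N α * Amat N a - 1))
    + P * Polynomial.C (Amat N a * BL N α + Kmat N)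

/-- The functional `p ↦ ∫₀^∞ e^{-x} x^β p(x) dx` on complex polynomials. -/
def laguerreFunctional (β : ℝ) (p : ℂ[X]) : ℂ :=
  ∫ x in Set.Ioi (0 : ℝ), ((Real.exp (-x) * x ^ β : ℝ) : ℂ) * p.eval (x : ℂ)

lemma laguerre_mul_pow {β x : ℝ} (hx : 0 < x) (k : ℕ) :
    Real.exp (-x) * x ^ β * x ^ k = Real.exp (-x) * x ^ ((β + k + 1) - 1) := by
  rw [add_sub_cancel_right, Real.rpow_add hx, Real.rpow_natCast, mul_assoc]

lemma integrableOn_laguerre {β : ℝ} (hβ : -1 < β) (p : ℂ[X]) :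
    IntegrableOn (fun x : ℝ => ((Real.exp (-x) * x ^ β : ℝ) : ℂ) * p.eval (x : ℂ))
      (Set.Ioi 0) := by
  induction p using Polynomial.induction_on' with
  | add p q hp hq =>
    refine (hp.add hq).congr (ae_of_all _ fun x => ?_)
    simp [mul_add]
  | monomial k c =>
    have h := Real.GammaIntegral_convergent (s := β + k + 1)
      (by have : (0 : ℝ) ≤ k := k.cast_nonneg
          linarith)
    have h' : IntegrableOn (fun x : ℝ => ((Real.exp (-x) * x ^ ((β + k + 1) - 1) : ℝ) : ℂ))
        (Set.Ioi 0) := h.ofReal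
    refine IntegrableOn.congr_fun (h'.const_mul c) (fun x hx => ?_) measurableSet_Ioi
    rw [← laguerre_mul_pow hx k]
    simp only [eval_monomial]
    push_cast
    ring

lemma laguerreFunctional_add {β : ℝ} (hβ : -1 < β) (p q : ℂ[X]) :
    laguerreFunctional β (p + q) = laguerreFunctional β p + laguerreFunctional β q := by
  unfold laguerreFunctional
  rw [← integral_add (integrableOn_laguerre hβ p) (integrableOn_laguerre hβ q)]
  simp [mul_add]

lemma laguerreFunctional_C_mul (β : ℝ) (c : ℂ) (p : ℂ[X]) :
    laguerreFunctional β (C c * p) = c * laguerreFunctional β p := by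
  unfold laguerreFunctional
  rw [← integral_const_mul]
  congr 1
  ext x
  simp only [eval_mul, eval_C]
  ring

lemma laguerreFunctional_sub {β : ℝ} (hβ : -1 < β) (p q : ℂ[X]) :
    laguerreFunctional β (p - q) = laguerreFunctional β p - laguerreFunctional β q := by
  have h := laguerreFunctional_add hβ (p - q) q
  rw [sub_add_cancel] at h
  rw [h, add_sub_cancel_right]

lemma laguerreFunctional_sum {β : ℝ} (hβ : -1 < β) {ι : Type*} (s : Finset ι) (p : ι → ℂ[X]) :
    laguerreFunctional β (∑ i ∈ s, p i) = ∑ i ∈ s, laguerreFunctional β (p i) := by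
  classical
  induction s using Finset.induction_on with
  | empty => simp [laguerreFunctional]
  | insert i s hi ih =>
    rw [Finset.sum_insert hi, Finset.sum_insert hi, laguerreFunctional_add hβ, ih]

lemma laguerreFunctional_X_pow {β : ℝ} (hβ : -1 < β) (k : ℕ) :
    laguerreFunctional β (X ^ k) = (Real.Gamma (β + k + 1) : ℂ) := by
  have : (0 : ℝ) ≤ k := k.cast_nonneg
  rw [Real.Gamma_eq_integral (by linarith), ← integral_complex_ofReal]
  refine setIntegral_congr_fun measurableSet_Ioi fun x hx => ?_
  rw [← laguerre_mul_pow hx k]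
  simp

/-- Integration by parts against the Laguerre weight. -/
lemma laguerreFunctional_derivative {β : ℝ} (hβ : -1 < β) (h : ℂ[X]) :
    laguerreFunctional β (X * derivative h + (C ((β + 1 : ℝ) : ℂ) - X) * h) = 0 := by
  induction h using Polynomial.induction_on' with
  | add p q hp hq =>
    have key : X * derivative (p + q) + (C ((β + 1 : ℝ) : ℂ) - X) * (p + q) =
        (X * derivative p + (C ((β + 1 : ℝ) : ℂ) - X) * p) +
          (X * derivative q + (C ((β + 1 : ℝ) : ℂ) - X) * q) := by
      rw [derivative_add]
      ring
    rw [key, laguerreFunctional_add hβ, hp, hq, add_zero]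
  | monomial k c =>
    have key : X * derivative (monomial k c) + (C ((β + 1 : ℝ) : ℂ) - X) * monomial k c
        = C (c * ((β + k + 1 : ℝ) : ℂ)) * X ^ k - C c * X ^ (k + 1) := by
      rw [← C_mul_X_pow_eq_monomial]
      rcases k with _ | k
      · simp
        ring
      · simp only [derivative_C_mul_X_pow, Nat.add_sub_cancel, Complex.ofReal_add, C_mul, C_add,
          Complex.ofReal_natCast, Complex.ofReal_one, C_1]
        ring
    have : (0 : ℝ) ≤ k := k.cast_nonneg
    rw [key, laguerreFunctional_sub hβ, laguerreFunctional_C_mul, laguerreFunctional_C_mul,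
      laguerreFunctional_X_pow hβ, laguerreFunctional_X_pow hβ]
    have hG : Real.Gamma (β + (k + 1 : ℕ) + 1) = (β + k + 1) * Real.Gamma (β + k + 1) := by
      rw [← Real.Gamma_add_one (by linarith)]
      push_cast
      ring_nf
    rw [hG]
    push_cast
    ring

/-- The Laguerre differential operator shifted by the constant `κ`. -/
def laguerreOp (β κ : ℝ) (f : ℂ[X]) : ℂ[X] :=
  X * derivative (derivative f) + (C ((β + 1 : ℝ) : ℂ) - X) * derivative f + C (κ : ℂ) * f

lemma laguerreOp_map_conj (β κ : ℝ) (f : ℂ[X]) :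
    (laguerreOp β κ f).map (starRingEnd ℂ) = laguerreOp β κ (f.map (starRingEnd ℂ)) := by
  simp [laguerreOp, derivative_map]

lemma laguerreFunctional_laguerreOp {β : ℝ} (hβ : -1 < β) (κ : ℝ) (f g : ℂ[X]) :
    laguerreFunctional β (laguerreOp β κ f * g) = laguerreFunctional β (f * laguerreOp β κ g) := by
  rw [← sub_eq_zero, ← laguerreFunctional_sub hβ,
    ← laguerreFunctional_derivative hβ (derivative f * g - f * derivative g)]
  congr 1
  simp only [laguerreOp, derivative_sub, derivative_mul]
  ring

lemma eval_map_conj_ofReal (p : ℂ[X]) (x : ℝ) :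
    (p.map (starRingEnd ℂ)).eval (x : ℂ) = starRingEnd ℂ (p.eval (x : ℂ)) := by
  conv_lhs => rw [← Complex.conj_ofReal x]
  rw [eval_map_apply]

lemma laguerre_mul_eval_mul_conj (β x : ℝ) (p : ℂ[X]) :
    ((Real.exp (-x) * x ^ β : ℝ) : ℂ) * (p * p.map (starRingEnd ℂ)).eval (x : ℂ)
      = ((Real.exp (-x) * x ^ β * ‖p.eval (x : ℂ)‖ ^ 2 : ℝ) : ℂ) := by
  rw [eval_mul, eval_map_conj_ofReal, Complex.mul_conj']
  push_cast
  ring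

lemma laguerreFunctional_mul_conj (β : ℝ) (p : ℂ[X]) :
    laguerreFunctional β (p * p.map (starRingEnd ℂ))
      = ((∫ x in Set.Ioi (0 : ℝ), Real.exp (-x) * x ^ β * ‖p.eval (x : ℂ)‖ ^ 2 : ℝ) : ℂ) := by
  rw [← integral_complex_ofReal]
  unfold laguerreFunctional
  simp only [laguerre_mul_eval_mul_conj]

lemma laguerre_sq_nonneg (β : ℝ) (p : ℂ[X]) {x : ℝ} (hx : 0 < x) :
    0 ≤ Real.exp (-x) * x ^ β * ‖p.eval (x : ℂ)‖ ^ 2 := by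
  positivity

lemma eq_zero_of_laguerre_integral_eq_zero {β : ℝ} (hβ : -1 < β) (p : ℂ[X])
    (h : ∫ x in Set.Ioi (0 : ℝ), Real.exp (-x) * x ^ β * ‖p.eval (x : ℂ)‖ ^ 2 = 0) : p = 0 := by
  have hint : IntegrableOn (fun x : ℝ => Real.exp (-x) * x ^ β * ‖p.eval (x : ℂ)‖ ^ 2)
      (Set.Ioi 0) := by
    have := (integrableOn_laguerre hβ (p * p.map (starRingEnd ℂ))).re
    refine this.congr (ae_of_all _ fun x => ?_)
    simp only
    rw [laguerre_mul_eval_mul_conj]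
    exact Complex.ofReal_re _
  have hcont : ContinuousOn (fun x : ℝ => Real.exp (-x) * x ^ β * ‖p.eval (x : ℂ)‖ ^ 2)
      (Set.Ioi 0) := by
    refine ContinuousOn.mul (ContinuousOn.mul (by fun_prop) ?_) (by fun_prop)
    exact fun x hx => (Real.continuousAt_rpow_const x β (Or.inl hx.ne')).continuousWithinAt
  have hae := (setIntegral_eq_zero_iff_of_nonneg_ae
    ((ae_restrict_iff' measurableSet_Ioi).2 (ae_of_all _ fun x hx => laguerre_sq_nonneg β p hx))
    hint).1 h
  have heq := Measure.eqOn_open_of_ae_eq hae isOpen_Ioi hcont continuousOn_const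
  refine Polynomial.eq_zero_of_infinite_isRoot p ?_
  refine ((Set.Ioi_infinite (0 : ℝ)).image Complex.ofReal_injective.injOn).mono ?_
  rintro _ ⟨x, hx, rfl⟩
  have hx0 : (0 : ℝ) < x := hx
  have hz : Real.exp (-x) * x ^ β * ‖p.eval (x : ℂ)‖ ^ 2 = 0 := heq hx
  have h1 : Real.exp (-x) * x ^ β ≠ 0 := by positivity
  simpa [h1] using hz

section MatrixPolynomials

variable {N : ℕ}

/-- The `(i, j)` entry of a matrix polynomial, as a scalar polynomial. -/
def polyEntry (P : (Mat N)[X]) (i j : Fin N) : ℂ[X] := matPolyEquiv.symm P i j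

@[simp] lemma coeff_polyEntry (P : (Mat N)[X]) (i j : Fin N) (k : ℕ) :
    (polyEntry P i j).coeff k = P.coeff k i j := by
  rw [polyEntry, ← matPolyEquiv_coeff_apply, AlgEquiv.apply_symm_apply]

lemma mval_apply (P : (Mat N)[X]) (x : ℝ) (i j : Fin N) :
    mval P x i j = (polyEntry P i j).eval (x : ℂ) := by
  rw [polyEntry, ← matPolyEquiv_eval, AlgEquiv.apply_symm_apply, mval]
  rw [smul_one_eq_diagonal]
  rfl

lemma polyEntry_mul (P Q : (Mat N)[X]) (i j : Fin N) :
    polyEntry (P * Q) i j = ∑ k, polyEntry P i k * polyEntry Q k j := by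
  simp [polyEntry, Matrix.mul_apply]

lemma polyEntry_add (P Q : (Mat N)[X]) (i j : Fin N) :
    polyEntry (P + Q) i j = polyEntry P i j + polyEntry Q i j := by
  simp [polyEntry]

lemma polyEntry_C (M : Mat N) (i j : Fin N) : polyEntry (C M) i j = C (M i j) := by
  ext k
  simp only [coeff_polyEntry, coeff_C]
  split_ifs <;> rfl

lemma polyEntry_derivative (P : (Mat N)[X]) (i j : Fin N) :
    polyEntry (derivative P) i j = derivative (polyEntry P i j) := by
  ext k
  simp only [coeff_polyEntry, coeff_derivative]
  rw [show ((k : Mat N) + 1) = ((k + 1 : ℕ) : Mat N) by push_cast; rfl, ← nsmul_eq_mul']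
  simp
  ring

lemma polyEntry_X_mul (P : (Mat N)[X]) (i j : Fin N) :
    polyEntry (X * P) i j = X * polyEntry P i j := by
  ext k
  rcases k with _ | k <;> simp [coeff_X_mul]

lemma polyEntry_mul_C_diagonal (P : (Mat N)[X]) (d : Fin N → ℂ) (i j : Fin N) :
    polyEntry (P * C (diagonal d)) i j = C (d j) * polyEntry P i j := by
  rw [polyEntry_mul]
  simp only [polyEntry_C]
  rw [Finset.sum_eq_single j]
  · simp [mul_comm]
  · intro k _ hk
    simp [hk]
  · simp

lemma mval_mul (P Q : (Mat N)[X]) (x : ℝ) : mval (P * Q) x = mval P x * mval Q x := by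
  ext i j
  simp only [Matrix.mul_apply, mval_apply, polyEntry_mul, eval_finsetSum, eval_mul]

lemma Amat_apply_eq_zero (a : ℕ → ℝ) (p q : Fin N)
    (h : ¬ (Odd ((p : ℕ) + 1) ∧ Even ((q : ℕ) + 1))) : Amat N a p q = 0 := by
  rw [Amat, Matrix.add_apply, Matrix.sum_apply, Matrix.sum_apply]
  rw [Finset.sum_eq_zero, Finset.sum_eq_zero, add_zero]
  · intro j hj
    simp only [EU, Matrix.smul_apply, Matrix.of_apply]
    rw [if_neg, smul_zero]
    rintro ⟨h1, h2⟩
    exact h ⟨⟨j, h1⟩, ⟨j, by omega⟩⟩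
  · intro j hj
    have := (Finset.mem_Icc.1 hj).1
    simp only [EU, Matrix.smul_apply, Matrix.of_apply]
    rw [if_neg, smul_zero]
    rintro ⟨h1, h2⟩
    exact h ⟨⟨j - 1, by omega⟩, ⟨j, by omega⟩⟩

lemma Kmat_eq_diagonal :
    Kmat N = diagonal fun i : Fin N => ((if Even ((i : ℕ) + 1) then 1 else 0 : ℝ) : ℂ) := by
  ext p q
  rw [Kmat, Matrix.sum_apply]
  simp only [EU, Matrix.of_apply, diagonal_apply]
  by_cases hpq : p = q ∧ Even ((p : ℕ) + 1)
  · obtain ⟨rfl, j, hj⟩ := hpq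
    have hp := p.2
    rw [Finset.sum_eq_single j]
    · rw [if_pos (by omega), if_pos rfl, if_pos ⟨j, hj⟩]
      simp
    · intro i _ hi
      rw [if_neg (by omega)]
    · intro hj'
      rw [Finset.mem_Icc] at hj'
      omega
  · rw [Finset.sum_eq_zero]
    · by_cases h : p = q
      · rw [if_pos h, if_neg fun he => hpq ⟨h, he⟩]
        simp
      · rw [if_neg h]
    · intro j _
      rw [if_neg]
      rintro ⟨h1, h2⟩
      exact hpq ⟨Fin.ext (by omega), ⟨j, by omega⟩⟩

lemma Amat_mul_diagonal_mul_Amat (a : ℕ → ℝ) (d : Fin N → ℂ) :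
    Amat N a * diagonal d * Amat N a = 0 := by
  ext p q
  rw [Matrix.mul_apply]
  refine Finset.sum_eq_zero fun k _ => ?_
  rw [mul_diagonal]
  rcases Nat.even_or_odd ((k : ℕ) + 1) with hk | hk
  · rw [Amat_apply_eq_zero a k q (by simp [Nat.not_odd_iff_even.2 hk]), mul_zero]
  · rw [Amat_apply_eq_zero a p k (by simp [Nat.not_even_iff_odd.2 hk]), zero_mul, zero_mul]

lemma Amat_mul_self (a : ℕ → ℝ) : Amat N a * Amat N a = 0 := by
  simpa using Amat_mul_diagonal_mul_Amat (N := N) a 1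

lemma Amat_mul_Kmat (a : ℕ → ℝ) : Amat N a * Kmat N = Amat N a := by
  ext p q
  rw [Kmat_eq_diagonal, mul_diagonal]
  by_cases hq : Even ((q : ℕ) + 1)
  · simp [hq]
  · rw [Amat_apply_eq_zero a p q (by simp [hq]), zero_mul]

lemma Kmat_mul_Amat (a : ℕ → ℝ) : Kmat N * Amat N a = 0 := by
  ext p q
  rw [Kmat_eq_diagonal, diagonal_mul]
  by_cases hp : Even ((p : ℕ) + 1)
  · rw [Amat_apply_eq_zero a p q (by simp [Nat.not_odd_iff_even.2 hp]), mul_zero]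
    rfl
  · simp [hp]

/-- `T(x) = I + x A` as a matrix polynomial. -/
def Tpoly (N : ℕ) (a : ℕ → ℝ) : (Mat N)[X] := 1 + X * C (Amat N a)

lemma mval_Tpoly (a : ℕ → ℝ) (x : ℝ) : mval (Tpoly N a) x = Tmat N a x := by
  ext i j
  rw [mval_apply, Tpoly, polyEntry_add, polyEntry_X_mul, polyEntry_C, ← C_1, polyEntry_C]
  simp [Tmat]
  exact mul_comm _ _

lemma one_add_mul_one_sub_of_central {R : Type*} [Ring R] {x A : R} (hx : ∀ q, x * q = q * x)
    (hA : A * A = 0) : (1 + x * A) * (1 - x * A) = 1 := by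
  have h : x * A * (x * A) = 0 := by
    rw [mul_assoc, hx A, ← mul_assoc A, hA, zero_mul, mul_zero]
  rw [add_mul, one_mul, mul_sub, h, mul_one, sub_zero, sub_add_cancel]

lemma Tpoly_mul_inv (a : ℕ → ℝ) : Tpoly N a * (1 - X * C (Amat N a)) = 1 :=
  one_add_mul_one_sub_of_central (fun _ => X_mul) (by rw [← C_mul, Amat_mul_self, C_0])

lemma conjugated_operator_identity {R : Type*} [Ring R] (x A B K p p1 p2 : R)
    (hx : ∀ q, x * q = q * x) (hAA : A * A = 0) (hABA : A * B * A = 0) (hAK : A * K = A)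
    (hKA : K * A = 0) :
    (x * p2 + p1 * (B + x * (2 • A + A * B - B * A - 1)) + p * (A * B + K)) * (1 + x * A) =
      x * (p2 * (1 + x * A) + p1 * A + p1 * A) + (p1 * (1 + x * A) + p * A) * B
        - x * (p1 * (1 + x * A) + p * A) + p * (1 + x * A) * K := by
  have hAA' : ∀ q, A * (A * q) = 0 := fun q => by rw [← mul_assoc, hAA, zero_mul]
  have hABA' : ∀ q, A * (B * (A * q)) = 0 := fun q => by
    rw [← mul_assoc, ← mul_assoc, hABA, zero_mul]
  have hAK' : ∀ q, A * (K * q) = A * q := fun q => by rw [← mul_assoc, hAK]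
  have hKA' : ∀ q, K * (A * q) = 0 := fun q => by rw [← mul_assoc, hKA, zero_mul]
  have hxA := hx A
  have hxB := hx B
  have hxK := hx K
  have hxp1 := hx p1
  have hxp2 := hx p2
  have hl : ∀ y q, x * (y * q) = y * (x * q) := fun y q => by
    rw [← mul_assoc, hx y, mul_assoc]
  have hlA := hl A
  have hlB := hl B
  have hlp := hl p
  have hlp1 := hl p1
  have hlp2 := hl p2
  simp only [two_smul, mul_add, add_mul, mul_sub, sub_mul, mul_one, mul_assoc, hAA', hABA',
    hAK', hKA', hxA, hxB, hxK, hxp1, hxp2, hlA, hlB, hlp, hlp1, hlp2, mul_zero]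
  abel

/-- The operator `D_L` is the conjugate by `T` of a diagonal Laguerre operator. -/
lemma DL_mul_Tpoly (a α : ℕ → ℝ) (P : (Mat N)[X]) :
    DL a α P * Tpoly N a =
      X * derivative (derivative (P * Tpoly N a))
        + derivative (P * Tpoly N a) * C (BL N α) - X * derivative (P * Tpoly N a)
        + P * Tpoly N a * C (Kmat N) := by
  have hT : derivative (Tpoly N a) = C (Amat N a) := by simp [Tpoly]
  have h := conjugated_operator_identity (X : (Mat N)[X]) (C (Amat N a)) (C (BL N α))
    (C (Kmat N)) P (derivative P) (derivative (derivative P)) (fun q => X_mul)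
    (by rw [← C_mul, Amat_mul_self, C_0])
    (by rw [← C_mul, ← C_mul, BL, Amat_mul_diagonal_mul_Amat, C_0])
    (by rw [← C_mul, Amat_mul_Kmat]) (by rw [← C_mul, Kmat_mul_Amat, C_0])
  simp only [derivative_mul, derivative_add, hT, derivative_C, mul_zero, add_zero]
  rw [DL]
  simp only [C_add, C_sub, C_mul, C_1, map_nsmul]
  exact h

/-- The entries of `P T`, on which `D_L` acts as scalar Laguerre operators. -/
lemma polyEntry_DL_mul_Tpoly (a α : ℕ → ℝ) (P : (Mat N)[X]) (i j : Fin N) :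
    polyEntry (DL a α P * Tpoly N a) i j =
      laguerreOp (α (j + 1)) (if Even ((j : ℕ) + 1) then 1 else 0)
        (polyEntry (P * Tpoly N a) i j) := by
  have hsub : ∀ U V : (Mat N)[X], polyEntry (U - V) i j = polyEntry U i j - polyEntry V i j :=
    fun U V => by simp [polyEntry]
  rw [DL_mul_Tpoly, polyEntry_add, hsub, polyEntry_add, polyEntry_X_mul, polyEntry_X_mul, BL,
    polyEntry_mul_C_diagonal, Kmat_eq_diagonal, polyEntry_mul_C_diagonal, polyEntry_derivative,
    polyEntry_derivative, laguerreOp]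
  ring

/-- The entries of the matrix inner product of `P` and `Q` defined by the weight `W_L`. -/
def weightForm (a α : ℕ → ℝ) (P Q : (Mat N)[X]) (s t : Fin N) : ℂ :=
  ∑ k : Fin N, laguerreFunctional (α (k + 1)) (polyEntry (P * Tpoly N a) s k *
    (polyEntry (Q * Tpoly N a) t k).map (starRingEnd ℂ))

lemma integral_eq_weightForm (a α : ℕ → ℝ) (hα : ∀ k : Fin N, -1 < α (k + 1))
    (P Q : (Mat N)[X]) (s t : Fin N) :
    ∫ x in Set.Ioi (0 : ℝ), (mval P x * WL N a α x * (mval Q x)ᴴ) s t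
      = weightForm a α P Q s t := by
  unfold weightForm laguerreFunctional
  rw [← integral_finsetSum _ fun k _ => integrableOn_laguerre (hα k) _]
  congr 1
  ext x
  have h : mval P x * WL N a α x * (mval Q x)ᴴ =
      mval (P * Tpoly N a) x * laguerreDiag N α x * (mval (Q * Tpoly N a) x)ᴴ := by
    rw [mval_mul, mval_mul, mval_Tpoly, conjTranspose_mul, WL]
    simp only [Matrix.mul_assoc]
  rw [h, Matrix.mul_apply]
  refine Finset.sum_congr rfl fun k _ => ?_
  rw [laguerreDiag, mul_diagonal, conjTranspose_apply, mval_apply, mval_apply, eval_mul,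
    eval_map_conj_ofReal,
    starRingEnd_apply]
  ring

section

variable {a α : ℕ → ℝ}

lemma weightForm_add_right (hα : ∀ k : Fin N, -1 < α (k + 1)) (P Q R : (Mat N)[X])
    (s t : Fin N) :
    weightForm a α P (Q + R) s t = weightForm a α P Q s t + weightForm a α P R s t := by
  simp only [weightForm, add_mul, polyEntry_add, Polynomial.map_add, mul_add,
    laguerreFunctional_add (hα _), Finset.sum_add_distrib]

lemma weightForm_add_left (hα : ∀ k : Fin N, -1 < α (k + 1)) (P Q R : (Mat N)[X])
    (s t : Fin N) :
    weightForm a α (P + Q) R s t = weightForm a α P R s t + weightForm a α Q R s t := by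
  simp only [weightForm, add_mul, polyEntry_add, laguerreFunctional_add (hα _),
    Finset.sum_add_distrib]

lemma weightForm_C_mul_right (hα : ∀ k : Fin N, -1 < α (k + 1)) (M : Mat N)
    (P Q : (Mat N)[X]) (s t : Fin N) :
    weightForm a α P (C M * Q) s t = ∑ u, starRingEnd ℂ (M t u) * weightForm a α P Q s u := by
  simp only [weightForm, Finset.mul_sum]
  rw [Finset.sum_comm]
  refine Finset.sum_congr rfl fun k _ => ?_
  rw [mul_assoc, polyEntry_mul (C M), Polynomial.map_sum, Finset.mul_sum,
    laguerreFunctional_sum (hα k)]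
  refine Finset.sum_congr rfl fun u _ => ?_
  rw [← laguerreFunctional_C_mul, polyEntry_C, Polynomial.map_mul, map_C, mul_left_comm]

lemma weightForm_C_mul_left (hα : ∀ k : Fin N, -1 < α (k + 1)) (M : Mat N)
    (P Q : (Mat N)[X]) (s t : Fin N) :
    weightForm a α (C M * P) Q s t = ∑ u, M s u * weightForm a α P Q u t := by
  simp only [weightForm, Finset.mul_sum]
  rw [Finset.sum_comm]
  refine Finset.sum_congr rfl fun k _ => ?_
  rw [mul_assoc, polyEntry_mul (C M), Finset.sum_mul, laguerreFunctional_sum (hα k)]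
  refine Finset.sum_congr rfl fun u _ => ?_
  rw [← laguerreFunctional_C_mul, polyEntry_C, mul_assoc]

/-- `D_L` is symmetric with respect to `W_L`. -/
lemma weightForm_DL (hα : ∀ k : Fin N, -1 < α (k + 1)) (P Q : (Mat N)[X]) (s t : Fin N) :
    weightForm a α (DL a α P) Q s t = weightForm a α P (DL a α Q) s t := by
  simp only [weightForm, polyEntry_DL_mul_Tpoly, laguerreOp_map_conj,
    laguerreFunctional_laguerreOp (hα _)]

lemma eq_zero_of_weightForm_self (hα : ∀ k : Fin N, -1 < α (k + 1)) (P : (Mat N)[X])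
    (h : ∀ s, weightForm a α P P s s = 0) : P = 0 := by
  have hPT : P * Tpoly N a = 0 := by
    apply matPolyEquiv.symm.injective
    rw [map_zero]
    ext1 s k
    change polyEntry (P * Tpoly N a) s k = 0
    have hs := h s
    simp only [weightForm, laguerreFunctional_mul_conj] at hs
    rw [← Complex.ofReal_sum, Complex.ofReal_eq_zero, Finset.sum_eq_zero_iff_of_nonneg
      fun k _ => setIntegral_nonneg measurableSet_Ioi fun x hx => laguerre_sq_nonneg _ _ hx] at hs
    exact eq_zero_of_laguerre_integral_eq_zero (hα k) _ (hs k (Finset.mem_univ k))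
  rw [← mul_one P, ← Tpoly_mul_inv a, ← mul_assoc, hPT, zero_mul]

end

lemma natDegree_DL_le (a α : ℕ → ℝ) (P : (Mat N)[X]) :
    (DL a α P).natDegree ≤ P.natDegree := by
  rcases Nat.eq_zero_or_pos P.natDegree with h0 | hpos
  · rw [natDegree_eq_zero] at h0
    obtain ⟨M, rfl⟩ := h0
    rw [DL, derivative_C, derivative_zero, mul_zero, zero_mul, zero_add, zero_add, ← C_mul,
      natDegree_C]
    exact Nat.zero_le _
  have h1 : (derivative P).natDegree ≤ P.natDegree - 1 := natDegree_derivative_le P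
  have h2 : (derivative (derivative P)).natDegree ≤ P.natDegree - 1 :=
    (natDegree_derivative_le _).trans (by omega)
  unfold DL
  refine natDegree_add_le_of_degree_le (natDegree_add_le_of_degree_le ?_ ?_) ?_
  · exact (natDegree_mul_le_of_le natDegree_X_le h2).trans (by omega)
  · refine (natDegree_mul_le_of_le (n := 1) h1 ?_).trans (by omega)
    refine natDegree_add_le_of_degree_le (by simp) ?_
    exact (natDegree_mul_le_of_le natDegree_X_le (natDegree_C _).le)
  · exact (natDegree_mul_le_of_le le_rfl (natDegree_C _).le)

lemma sub_C_mul_eq_add {R : Type*} [Ring R] (c : R) (P Q : R[X]) :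
    P - C c * Q = P + C (-c) * Q := by
  rw [C_neg, neg_mul, sub_eq_add_neg]

lemma coeff_sub_C_mul_monic {R : Type*} [Ring R] {d : ℕ} {P Q : R[X]} (hdeg : P.natDegree = d)
    (hmonic : P.Monic) (hQ : ∀ k, d < k → Q.coeff k = 0) (k : ℕ) (hk : d ≤ k) :
    (Q - C (Q.coeff d) * P).coeff k = 0 := by
  rw [coeff_sub, coeff_C_mul]
  rcases hk.eq_or_lt with rfl | hk
  · rw [← hdeg, coeff_natDegree, hmonic.leadingCoeff, mul_one, sub_self]
  · have hP : P.coeff k = 0 := coeff_eq_zero_of_natDegree_lt (by omega)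
    rw [hQ k hk, hP, mul_zero, sub_zero]

/-- Monic polynomials of degrees `0, …, d - 1` generate all polynomials of degree `< d`. -/
lemma monic_sequence_induction {R : Type*} [Ring R] {P : ℕ → R[X]}
    (hdeg : ∀ n, (P n).natDegree = n) (hmonic : ∀ n, (P n).Monic) (V : R[X] → Prop)
    (hzero : V 0) (hadd : ∀ p q, V p → V q → V (p + q)) (hsmul : ∀ c p, V p → V (C c * p))
    (d : ℕ) (hP : ∀ m < d, V (P m)) (Q : R[X]) (hQ : ∀ k, d ≤ k → Q.coeff k = 0) : V Q := by
  induction d generalizing Q with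
  | zero =>
    rw [show Q = 0 from Polynomial.ext fun k => hQ k k.zero_le]
    exact hzero
  | succ d ih =>
    have h := hadd _ _ (ih (fun m hm => hP m (by omega)) _
      (coeff_sub_C_mul_monic (hdeg d) (hmonic d) fun k hk => hQ k hk))
      (hsmul (Q.coeff d) _ (hP d (by omega)))
    rwa [sub_add_cancel] at h

end MatrixPolynomials

/-- the monic orthogonal polynomials of `W_L` are eigenfunctions of `D_L`. -/
theorem stmt1 (N : ℕ) (hN : 2 ≤ N) (a : ℕ → ℝ)
    (ha : ∀ j, 1 ≤ j → j ≤ N - 1 → a j ≠ 0)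
    (α : ℕ → ℝ)
    (hα : ∀ j, 1 ≤ j → j ≤ N → -1 < α j)
    (hαint : ∀ i j, 1 ≤ i → i ≤ N → 1 ≤ j → j ≤ N → i ≠ j →
      ¬ ∃ k : ℤ, α i - α j = (k : ℝ))
    (P : ℕ → Polynomial (Mat N))
    (hdeg : ∀ n, (P n).natDegree = n)
    (hmonic : ∀ n, (P n).Monic)
    (horth : ∀ n m, n ≠ m → ∀ s t : Fin N,
      ∫ x in Set.Ioi (0 : ℝ), (mval (P n) x * WL N a α x * (mval (P m) x)ᴴ) s t = 0) :
    ∀ n : ℕ, ∃ Λ : Mat N, DL a α (P n) = Polynomial.C Λ * P n := by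
  have hα' : ∀ k : Fin N, -1 < α (k + 1) := fun k => hα _ (by omega) (by omega)
  simp only [integral_eq_weightForm a α hα'] at horth
  have low : ∀ F : (Mat N)[X], ∀ d, (∀ m < d, ∀ s t, weightForm a α F (P m) s t = 0) →
      ∀ Q : (Mat N)[X], (∀ k, d ≤ k → Q.coeff k = 0) → ∀ s t, weightForm a α F Q s t = 0 := by
    intro F d hF Q hQ
    refine monic_sequence_induction hdeg hmonic (fun Q => ∀ s t, weightForm a α F Q s t = 0)
      ?_ ?_ ?_ d hF Q hQ
    · intro s t
      have h := weightForm_add_right (a := a) hα' F 0 0 s t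
      rw [add_zero] at h
      exact left_eq_add.1 h
    · intro p q hp hq s t
      rw [weightForm_add_right hα', hp, hq, add_zero]
    · intro c p hp s t
      rw [weightForm_C_mul_right hα']
      simp [hp]
  intro n
  refine ⟨(DL a α (P n)).coeff n, ?_⟩
  rw [← sub_eq_zero]
  refine eq_zero_of_weightForm_self (a := a) hα' _ fun s => ?_
  refine low _ n (fun m hm s t => ?_) _ (coeff_sub_C_mul_monic (hdeg n) (hmonic n) fun k hk =>
    coeff_eq_zero_of_natDegree_lt (((natDegree_DL_le a α _).trans (hdeg n).le).trans_lt hk)) s s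
  have h1 : weightForm a α (DL a α (P n)) (P m) s t = 0 := by
    rw [weightForm_DL hα']
    refine low _ n (fun m hm => horth n m hm.ne') _ (fun k hk => ?_) s t
    exact coeff_eq_zero_of_natDegree_lt
      (((natDegree_DL_le a α _).trans (hdeg m).le).trans_lt (hm.trans_le hk))
  rw [sub_C_mul_eq_add, weightForm_add_left hα', weightForm_C_mul_left hα', h1]
  simp [horth n m hm.ne']
end
end

section
/- The Hermite-type weight W_H is irreducible: there do not exist an invertible matrix M ∈ Mat_N(ℂ) and an integer k with 1 ≤ k ≤ N−1 such that for every x ∈ ℝ the matrix M W_H(x) M^* is block diagonal with diagonal blocks of sizes k and N−k, i.e., such that (M W_H(x) M^*)_{s,t} = 0 for all x ∈ ℝ whenever s ≤ k < t or t ≤ k < s. -/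
open Polynomial MeasureTheory Matrix

noncomputable section

/-- The diagonal Hermite weight `diag(e^{-x²+2b₁x}, …, e^{-x²+2b_Nx})` (1-indexed `b`). -/
def hermiteDiag (N : ℕ) (b : ℕ → ℝ) (x : ℝ) : Mat N :=
  Matrix.diagonal fun i => (Real.exp (-x ^ 2 + 2 * b ((i : ℕ) + 1) * x) : ℂ)

/-- The Hermite-type weight `W_H(x) = T(x) · diag(…) · T(x)^*`. -/
def WH (N : ℕ) (a b : ℕ → ℝ) (x : ℝ) : Mat N :=
  Tmat N a x * hermiteDiag N b x * (Tmat N a x)ᴴ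

theorem tendsto_eval_mul_exp_neg (p : ℂ[X]) {d : ℝ} (hd : d < 0) :
    Filter.Tendsto (fun x : ℝ => p.eval (x : ℂ) * (Real.exp (d * x) : ℂ))
      Filter.atTop (nhds 0) := by
  simp only [Polynomial.eval_eq_sum, Polynomial.sum_def, Finset.sum_mul]
  rw [← Finset.sum_const_zero (s := p.support)]
  refine tendsto_finsetSum _ fun n _ => ?_
  have h := (isLittleO_pow_exp_pos_mul_atTop n (neg_pos.2 hd)).tendsto_div_nhds_zero
  have h2 := (Complex.continuous_ofReal.tendsto 0).comp h
  have h3 := h2.const_mul (p.coeff n)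
  rw [Complex.ofReal_zero, mul_zero] at h3
  refine h3.congr fun x => ?_
  simp only [Function.comp_apply, div_eq_mul_inv, ← Real.exp_neg]
  push_cast
  rw [neg_mul, neg_neg, mul_assoc]

theorem eq_zero_of_tendsto_eval_ofReal (p : ℂ[X])
    (h : Filter.Tendsto (fun x : ℝ => p.eval (x : ℂ)) Filter.atTop (nhds 0)) : p = 0 := by
  rcases lt_or_ge 0 p.degree with hp | hp
  · have hz : Filter.Tendsto (fun x : ℝ => ‖(x : ℂ)‖) Filter.atTop Filter.atTop := by
      simpa using Filter.tendsto_abs_atTop_atTop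
    exact absurd h.norm (not_tendsto_nhds_of_tendsto_atTop (p.tendsto_norm_atTop hp hz) _)
  · rw [Polynomial.eq_C_of_degree_le_zero hp] at h ⊢
    simp only [Polynomial.eval_C] at h
    rw [tendsto_nhds_unique tendsto_const_nhds h, Polynomial.C_0]

/-- Exponentials with distinct real rates are linearly independent over polynomials. -/
theorem eq_zero_of_sum_eval_mul_exp_eq_zero {ι : Type*} [DecidableEq ι] (c : ι → ℝ)
    (p : ι → ℂ[X]) (S : Finset ι) (hc : Set.InjOn c S)
    (h : ∀ x : ℝ, ∑ i ∈ S, (p i).eval (x : ℂ) * (Real.exp (c i * x) : ℂ) = 0) :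
    ∀ i ∈ S, p i = 0 := by
  induction S using Finset.induction_on_max_value c with
  | empty => simp
  | insert m S hm hmax ih =>
    have hlt : ∀ i ∈ S, c i < c m := fun i hi => lt_of_le_of_ne (hmax i hi) fun he =>
      hm (hc (Finset.mem_insert_of_mem hi) (Finset.mem_insert_self m S) he ▸ hi)
    have hdecay : ∀ i ∈ S, Filter.Tendsto
        (fun x : ℝ => (p i).eval (x : ℂ) * (Real.exp ((c i - c m) * x) : ℂ))
        Filter.atTop (nhds 0) := fun i hi =>
      tendsto_eval_mul_exp_neg (p i) (sub_neg.2 (hlt i hi))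
    have hsum := tendsto_finsetSum S hdecay
    have heq : ∀ x : ℝ, (p m).eval (x : ℂ) =
        -∑ i ∈ S, (p i).eval (x : ℂ) * (Real.exp ((c i - c m) * x) : ℂ) := by
      intro x
      have hx := h x
      rw [Finset.sum_insert hm] at hx
      have hE : (Real.exp (c m * x) : ℂ) ≠ 0 := by exact_mod_cast (Real.exp_pos _).ne'
      apply mul_right_cancel₀ hE
      rw [eq_neg_of_add_eq_zero_left hx, neg_mul, Finset.sum_mul]
      congr 1
      refine Finset.sum_congr rfl fun i _ => ?_
      rw [mul_assoc, ← Complex.ofReal_mul, ← Real.exp_add]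
      congr 3
      ring
    have hpm : p m = 0 := by
      apply eq_zero_of_tendsto_eval_ofReal
      simp only [heq]
      simpa using hsum.neg
    have hS := ih (hc.mono (by simp)) fun x => by
      simpa [Finset.sum_insert hm, hpm] using h x
    intro i hi
    rcases Finset.mem_insert.1 hi with rfl | hi
    · exact hpm
    · exact hS i hi

theorem eq_zero_of_C_add_C_mul_X_eq_zero {u v : ℂ} (h : C u + C v * X = (0 : ℂ[X])) :
    u = 0 ∧ v = 0 :=
  ⟨by simpa using congrArg (fun q => q.coeff 0) h, by simpa using congrArg (fun q => q.coeff 1) h⟩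

/-- If every column of an invertible `M` is supported in `P` or off `P`, and both the `c`-th
columns of `M` and of `M * A` vanish on `P`, then so do the columns of `M` that enter
the `c`-th column of `M * A`. -/
theorem column_eq_zero_of_mul_column_eq_zero {n : Type*} [Fintype n] [DecidableEq n]
    {M A : Matrix n n ℂ} (hM : IsUnit M) (P : n → Prop)
    (hcol : ∀ j, (∀ s, P s → M s j = 0) ∨ (∀ s, ¬ P s → M s j = 0))
    {c i : n} (hc : ∀ s, P s → (M * A) s c = 0) (hA : A i c ≠ 0) :
    ∀ s, P s → M s i = 0 := by
  classical
  by_contra hi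
  let w : n → ℂ := fun j => if ∀ s, P s → M s j = 0 then 0 else A j c
  have hw : M *ᵥ w = M *ᵥ 0 := by
    rw [Matrix.mulVec_zero]
    funext s
    by_cases hs : P s
    · rw [Pi.zero_apply, ← hc s hs, Matrix.mul_apply]
      refine Finset.sum_congr rfl fun j _ => ?_
      by_cases hj : ∀ s, P s → M s j = 0
      · simp [hj s hs]
      · simp only [w, if_neg hj]
    · refine Finset.sum_eq_zero fun j _ => ?_
      by_cases hj : ∀ s, P s → M s j = 0
      · simp only [w, if_pos hj, mul_zero]
      · exact mul_eq_zero_of_left ((hcol j).resolve_left hj s hs) _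
  have h0 := congrFun (Matrix.mulVec_injective_iff_isUnit.2 hM hw) i
  simp only [w, if_neg hi, Pi.zero_apply] at h0
  exact hA h0

theorem exists_ne_zero_of_isUnit {n : Type*} [Fintype n] [DecidableEq n]
    {M : Matrix n n ℂ} (hM : IsUnit M) (s : n) : ∃ j, M s j ≠ 0 := by
  by_contra! h
  have hdet := (Matrix.isUnit_iff_isUnit_det M).1 hM
  rw [Matrix.det_eq_zero_of_row_eq_zero s h] at hdet
  exact not_isUnit_zero hdet

theorem Amat_succ_right {N : ℕ} (a : ℕ → ℝ) {i j : Fin N} (hij : (j : ℕ) = i + 1)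
    (hi : Even (i : ℕ)) : Amat N a i j = a (i + 1) := by
  obtain ⟨l, hl⟩ := hi
  have hj := j.isLt
  simp only [Amat, EU, Matrix.add_apply, Matrix.sum_apply, Matrix.smul_apply, Matrix.of_apply,
    smul_eq_mul, mul_ite, mul_one, mul_zero]
  rw [Finset.sum_eq_single (l + 1), Finset.sum_eq_zero, if_pos (by omega), add_zero]
  · congr 2
    omega
  · intro m _
    rw [if_neg (by omega)]
  · intro m _ hm
    rw [if_neg (by omega)]
  · intro hm
    exact absurd (Finset.mem_Icc.2 (by omega)) hm

theorem Amat_succ_left {N : ℕ} (a : ℕ → ℝ) {i j : Fin N} (hij : (j : ℕ) = i + 1)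
    (hi : Odd (i : ℕ)) : Amat N a j i = a (i + 1) := by
  obtain ⟨l, hl⟩ := hi
  have hj := j.isLt
  simp only [Amat, EU, Matrix.add_apply, Matrix.sum_apply, Matrix.smul_apply, Matrix.of_apply,
    smul_eq_mul, mul_ite, mul_one, mul_zero]
  rw [Finset.sum_eq_zero, Finset.sum_eq_single (l + 1), if_pos (by omega), zero_add]
  · congr 2
    omega
  · intro m _ hm
    rw [if_neg (by omega)]
  · intro hm
    exact absurd (Finset.mem_Icc.2 (by omega)) hm
  · intro m _
    rw [if_neg (by omega)]

theorem mul_WH_mul_conjTranspose_apply {N : ℕ} (a b : ℕ → ℝ) (M : Mat N) (x : ℝ) (s t : Fin N) :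
    (M * WH N a b x * Mᴴ) s t = (Real.exp (-x ^ 2) : ℂ) * ∑ j : Fin N,
      ((C (M s j) + C ((M * Amat N a) s j) * X) *
        (C (star (M t j)) + C (star ((M * Amat N a) t j)) * X)).eval (x : ℂ) *
        (Real.exp (2 * b (j + 1) * x) : ℂ) := by
  have hW : M * WH N a b x * Mᴴ = (M + (x : ℂ) • (M * Amat N a)) * hermiteDiag N b x *
      (M + (x : ℂ) • (M * Amat N a))ᴴ := by
    have hT : M * Tmat N a x = M + (x : ℂ) • (M * Amat N a) := by
      rw [Tmat, mul_add, mul_one, Matrix.mul_smul]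
    rw [← hT, Matrix.conjTranspose_mul, WH]
    simp only [Matrix.mul_assoc]
  rw [hW, hermiteDiag, Matrix.mul_apply, Finset.mul_sum]
  refine Finset.sum_congr rfl fun j _ => ?_
  rw [Matrix.mul_diagonal, Matrix.conjTranspose_apply, Real.exp_add]
  simp only [Matrix.add_apply, Matrix.smul_apply, smul_eq_mul, star_add, star_mul',
    eval_mul, eval_add, eval_C, eval_X, Complex.ofReal_mul, Complex.star_def, Complex.conj_ofReal]
  ring

theorem column_eq_zero_or_of_mul_WH_eq_zero {N : ℕ} (a b : ℕ → ℝ)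
    (hb : Function.Injective fun j : Fin N => b (j + 1)) (M : Mat N) (P : Fin N → Prop)
    (h : ∀ x s t, P s → ¬ P t → (M * WH N a b x * Mᴴ) s t = 0) (j : Fin N) :
    (∀ s, P s → M s j = 0 ∧ (M * Amat N a) s j = 0) ∨
      (∀ s, ¬ P s → M s j = 0 ∧ (M * Amat N a) s j = 0) := by
  by_contra! hne
  obtain ⟨⟨s, hs, hsj⟩, ⟨t, ht, htj⟩⟩ := hne
  have hp := eq_zero_of_sum_eval_mul_exp_eq_zero (fun j : Fin N => 2 * b (j + 1))
    (fun j => (C (M s j) + C ((M * Amat N a) s j) * X) *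
        (C (star (M t j)) + C (star ((M * Amat N a) t j)) * X)) Finset.univ
    (fun i _ j _ hij => hb (mul_left_cancel₀ two_ne_zero hij))
    (fun x => by
      have hx := h x s t hs ht
      rw [mul_WH_mul_conjTranspose_apply] at hx
      exact (mul_eq_zero.1 hx).resolve_left (by exact_mod_cast (Real.exp_pos _).ne'))
    j (Finset.mem_univ j)
  rcases mul_eq_zero.1 hp with h0 | h0
  · have := eq_zero_of_C_add_C_mul_X_eq_zero h0
    exact hsj this.1 this.2
  · have := eq_zero_of_C_add_C_mul_X_eq_zero h0
    exact htj (star_eq_zero.1 this.1) (star_eq_zero.1 this.2)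

/-- the Hermite-type weight `W_H` is irreducible: no invertible constant matrix `M`
conjugates `W_H(x)` into a nontrivial block-diagonal form simultaneously for all `x ∈ ℝ`.
Indices are 1-based: entry `(s,t)` of the matrix corresponds to `s = (s₀:ℕ)+1`, etc. -/
theorem stmt7 (N : ℕ) (hN : 2 ≤ N) (a : ℕ → ℝ)
    (ha : ∀ j, 1 ≤ j → j ≤ N - 1 → a j ≠ 0)
    (b : ℕ → ℝ)
    (hb : ∀ i j, 1 ≤ i → i ≤ N → 1 ≤ j → j ≤ N → i ≠ j → b i ≠ b j) :
    ¬ ∃ (M : Mat N) (k : ℕ), IsUnit M ∧ 1 ≤ k ∧ k ≤ N - 1 ∧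
        ∀ x : ℝ, ∀ s t : Fin N,
          (((s : ℕ) + 1 ≤ k ∧ k < (t : ℕ) + 1) ∨ ((t : ℕ) + 1 ≤ k ∧ k < (s : ℕ) + 1)) →
          (M * WH N a b x * Mᴴ) s t = 0 := by
  rintro ⟨M, k, hM, hk1, hkN, h⟩
  let P : Fin N → Prop := fun s => (s : ℕ) + 1 ≤ k
  have hbinj : Function.Injective fun j : Fin N => b (j + 1) := by
    intro i j hij
    by_contra hne
    exact hb (i + 1) (j + 1) (by omega) (by omega) (by omega) (by omega)
      (fun he => hne (Fin.ext (by omega))) hij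
  have hcol := column_eq_zero_or_of_mul_WH_eq_zero a b hbinj M P
    fun x s t hs ht => h x s t (Or.inl ⟨hs, not_le.1 ht⟩)
  have hex : ∀ j, ¬ ((∀ s, P s → M s j = 0) ∧ (∀ s, ¬ P s → M s j = 0)) := by
    rintro j ⟨h1, h2⟩
    obtain ⟨t, ht⟩ := exists_ne_zero_of_isUnit (M := Mᵀ) (by simpa using hM) j
    exact ht (by by_cases hp : P t; exacts [h1 t hp, h2 t hp])
  have hcolM : ∀ j, (∀ s, P s → M s j = 0) ∨ (∀ s, ¬ P s → M s j = 0) := fun j =>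
    (hcol j).imp (fun hj s hs => (hj s hs).1) (fun hj s hs => (hj s hs).1)
  have hlink : ∀ i c, Amat N a i c ≠ 0 →
      ((∀ s, P s → M s i = 0) ↔ (∀ s, P s → M s c = 0)) := by
    intro i c hA
    rcases hcol c with hc | hc
    · exact iff_of_true (column_eq_zero_of_mul_column_eq_zero hM P hcolM
        (fun s hs => (hc s hs).2) hA) fun s hs => (hc s hs).1
    · have hi := column_eq_zero_of_mul_column_eq_zero hM (fun s => ¬ P s)
        (fun j => by simpa only [not_not] using (hcolM j).symm) (fun s hs => (hc s hs).2) hA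
      exact iff_of_false (fun h1 => hex i ⟨h1, hi⟩)
        fun h1 => hex c ⟨h1, fun s hs => (hc s hs).1⟩
  have hall : ∀ m (hm : m < N), (∀ s, P s → M s ⟨m, hm⟩ = 0) ↔
      (∀ s, P s → M s ⟨0, by omega⟩ = 0) := by
    intro m
    induction m with
    | zero => exact fun _ => Iff.rfl
    | succ m ih =>
      intro hm
      rw [← ih (by omega)]
      have ham : (a (m + 1) : ℂ) ≠ 0 := by exact_mod_cast ha (m + 1) (by omega) (by omega)
      rcases Nat.even_or_odd m with he | ho
      · refine (hlink ⟨m, by omega⟩ ⟨m + 1, hm⟩ ?_).symm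
        rwa [Amat_succ_right a rfl he]
      · refine hlink ⟨m + 1, hm⟩ ⟨m, by omega⟩ ?_
        rwa [Amat_succ_left a rfl ho]
  by_cases h0 : ∀ s, P s → M s ⟨0, by omega⟩ = 0
  · obtain ⟨j, hj⟩ := exists_ne_zero_of_isUnit hM ⟨0, by omega⟩
    exact hj ((hall j j.isLt).2 h0 _ (by simp only [P]; omega))
  · obtain ⟨j, hj⟩ := exists_ne_zero_of_isUnit hM ⟨N - 1, by omega⟩
    exact hj ((hcolM j).resolve_left (fun hj' => h0 ((hall j j.isLt).1 hj')) _
      (by simp only [P]; omega))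
end
end
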